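/- Let G be a nontrivial finite abelian group, let k and ℓ be nonnegative integers, let σ be a partition of n−k and τ a partition of n−ℓ, so that (σ,(k)) and (τ,(ℓ)) are double partitions of n. Then (σ,(k)) ≽_G (τ,(ℓ)) if and only if k ≤ ℓ and σ∪(k) ⊴ τ∪(ℓ). -/

import Mathlib

/-- The monoid hom `Perm (Fin n) →* MulAut (Fin n → G)`, permuting coordinates. -/
def permMulAut (G : Type*) [CommGroup G] (n : ℕ) :
    Equiv.Perm (Fin n) →* MulAut (Fin n → G) where
  toFun π := MulEquiv.arrowCongr π (MulEquiv.refl G)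
  map_one' := by ext f a; rfl
  map_mul' := by intro π σ; ext f a; rfl

/-- The wreath product `G ≀ Sₙ`. -/
abbrev Wr (G : Type*) [CommGroup G] (n : ℕ) :=
  SemidirectProduct (Fin n → G) (Equiv.Perm (Fin n)) (permMulAut G n)

/-- The natural action of `G ≀ Sₙ` on `G × [n]`. -/
def wAct {G : Type*} [CommGroup G] {n : ℕ} (w : Wr G n) (p : G × Fin n) : G × Fin n :=
  (p.1 * w.left (w.right p.2), w.right p.2)

/-- The `i`-th largest part of a multiset of naturals (0-indexed; `0` beyond the last part). -/
def dparts (s : Multiset ℕ) (i : ℕ) : ℕ := ((s.sort (· ≤ ·)).reverse).getD i 0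

/-- `s` is dominated by `t`. -/
def msDom (s t : Multiset ℕ) : Prop :=
  ∀ k, (((s.sort (· ≤ ·)).reverse).take k).sum ≤ (((t.sort (· ≤ ·)).reverse).take k).sum

/-- `T` is a `(σ,ρ)`-tabloid: the first component assigns to each element of `[n]` a block
(`Sum.inl i` is the block of the `i+1`-st largest part of `σ`, `Sum.inr j` that of `ρ`),
blocks have the prescribed sizes, and the colouring (second component)
is normalised to `1` on the `ρ`-blocks. -/
def IsTabloid (G : Type*) [CommGroup G] (n : ℕ) (σ ρ : Multiset ℕ)
    (T : (Fin n → ℕ ⊕ ℕ) × (Fin n → G)) : Prop :=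
  (∀ i, Nat.card {a : Fin n // T.1 a = Sum.inl i} = dparts σ i) ∧
  (∀ j, Nat.card {a : Fin n // T.1 a = Sum.inr j} = dparts ρ j) ∧
  (∀ a j, T.1 a = Sum.inr j → T.2 a = 1)

/-- The action of the wreath product on (raw) tabloids. -/
def tabAct {G : Type*} [CommGroup G] {n : ℕ} (w : Wr G n)
    (T : (Fin n → ℕ ⊕ ℕ) × (Fin n → G)) : (Fin n → ℕ ⊕ ℕ) × (Fin n → G) :=
  ⟨fun a => T.1 (w.right⁻¹ a),
   fun a => match T.1 (w.right⁻¹ a) with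
     | Sum.inl _ => T.2 (w.right⁻¹ a) * w.left a
     | Sum.inr _ => 1⟩

/-- A subset `Y` of `W` is transitive on `S ⊆ Ω` (w.r.t. an action `act`): there is a
constant `c > 0` such that any `a ∈ S` is mapped to any `b ∈ S` by exactly `c` elements of `Y`. -/
def IsTransitiveOn {W Ω : Type*} (act : W → Ω → Ω) (S : Set Ω) (Y : Set W) : Prop :=
  ∃ c : ℕ, 0 < c ∧ ∀ a ∈ S, ∀ b ∈ S, Nat.card {y : W // y ∈ Y ∧ act y a = b} = c

/-- `Y ⊆ G ≀ Sₙ` is `(σ,ρ)`-transitive. -/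
def DPTransitive (G : Type*) [CommGroup G] (n : ℕ) (σ ρ : Multiset ℕ)
    (Y : Set (Wr G n)) : Prop :=
  IsTransitiveOn tabAct {T | IsTabloid G n σ ρ T} Y

/-- `(σ,ρ) ≽_G (τ,π)` : every `(σ,ρ)`-transitive subset of `G ≀ Sₙ` is `(τ,π)`-transitive. -/
def DPDom (G : Type*) [CommGroup G] (n : ℕ) (σ ρ τ π : Multiset ℕ) : Prop :=
  ∀ Y : Set (Wr G n), DPTransitive G n σ ρ Y → DPTransitive G n τ π Y

/-- The partition obtained by adding `k` to the `r`-th largest part (1-indexed). -/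
def addPart (s : Multiset ℕ) (r k : ℕ) : Multiset ℕ :=
  s.erase (dparts s (r - 1)) + {dparts s (r - 1) + k}


open Finset in
/-- Injectivity of the subset inclusion matrices. -/
theorem incl_inj {α : Type*} [DecidableEq α] (U : Finset α) :
    ∀ (s t : ℕ) (u : Finset α → ℚ), s ≤ t → s + t ≤ U.card →
      (∀ B ⊆ U, B.card = t → ∑ A ∈ B.powersetCard s, u A = 0) →
      ∀ A ⊆ U, A.card = s → u A = 0 := by
  induction U using Finset.induction_on with
  | empty =>
    intro s t u hst hc h A hA hAs
    simp at hc
    obtain ⟨rfl, rfl⟩ := hc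
    have := h A hA hAs
    rw [Finset.subset_empty] at hA
    subst hA
    simpa using this
  | insert z U hz ih =>
    intro s t u hst hc h A hA hAs
    rw [Finset.card_insert_of_notMem hz] at hc
    rcases hst.eq_or_lt with rfl | hlt
    · have := h A hA hAs
      rw [← hAs, Finset.powersetCard_self] at this
      simpa using this
    rcases Nat.eq_zero_or_pos s with rfl | hs
    · obtain ⟨B, hB, hBt⟩ := Finset.exists_subset_card_eq (s := insert z U) (n := t)
        (by rw [Finset.card_insert_of_notMem hz]; omega)
      have := h B hB hBt
      rw [Finset.card_eq_zero] at hAs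
      subst hAs
      simpa using this
    obtain ⟨s, rfl⟩ : ∃ s', s = s' + 1 := ⟨s - 1, by omega⟩
    obtain ⟨t, rfl⟩ : ∃ t', t = t' + 1 := ⟨t - 1, by omega⟩
    -- B containing z
    have h2 : ∀ B ⊆ U, B.card = t →
        ∑ A ∈ B.powersetCard (s+1), u A + ∑ A ∈ B.powersetCard s, u (insert z A) = 0 := by
      intro B hB hBt
      have hzB : z ∉ B := fun hh => hz (hB hh)
      have := h (insert z B) (Finset.insert_subset_insert z hB)
        (by rw [Finset.card_insert_of_notMem hzB, hBt])
      rw [Finset.powersetCard_succ_insert hzB, Finset.sum_union, Finset.sum_image] at this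
      · exact this
      · intro A1 h1 A2 h2 he
        have hz1 : z ∉ A1 := fun hh => hzB ((Finset.mem_powersetCard.1 h1).1 hh)
        have hz2 : z ∉ A2 := fun hh => hzB ((Finset.mem_powersetCard.1 h2).1 hh)
        rw [← Finset.erase_insert hz1, ← Finset.erase_insert hz2, he]
      · rw [Finset.disjoint_left]
        intro A1 h1 h2
        rw [Finset.mem_image] at h2
        obtain ⟨A2, _, rfl⟩ := h2
        exact hzB ((Finset.mem_powersetCard.1 h1).1 (Finset.mem_insert_self _ _))
    -- double counting
    have dc : ∀ (r : ℕ) (v : Finset α → ℚ) (B : Finset α), B.card = t + 1 → r ≤ t →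
        ∑ B' ∈ B.powersetCard t, ∑ A ∈ B'.powersetCard r, v A
          = ((t + 1 - r : ℕ) : ℚ) * ∑ A ∈ B.powersetCard r, v A := by
      intro r v B hB hr
      rw [Finset.sum_comm' (t' := B.powersetCard r)
        (s' := fun A => (B.powersetCard t).filter (fun B' => A ⊆ B'))]
      · rw [Finset.mul_sum]
        apply Finset.sum_congr rfl
        intro A hA
        rw [Finset.mem_powersetCard] at hA
        rw [Finset.sum_const, nsmul_eq_mul]
        congr 2
        have : (B.powersetCard t).filter (fun B' => A ⊆ B') =
            (B \ A).image (fun x => B.erase x) := by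
          ext B'
          simp only [Finset.mem_filter, Finset.mem_powersetCard, Finset.mem_image,
            Finset.mem_sdiff]
          constructor
          · rintro ⟨⟨h1, h2⟩, h3⟩
            have : (B \ B').card = 1 := by
              rw [Finset.card_sdiff_of_subset h1]; omega
            obtain ⟨x, hx⟩ := Finset.card_eq_one.1 this
            have hxm : x ∈ B \ B' := by rw [hx]; simp
            rw [Finset.mem_sdiff] at hxm
            refine ⟨x, ⟨hxm.1, fun hh => hxm.2 (h3 hh)⟩, ?_⟩
            rw [Finset.erase_eq, ← hx, Finset.sdiff_sdiff_eq_self h1]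
          · rintro ⟨x, ⟨h1, h2⟩, rfl⟩
            refine ⟨⟨Finset.erase_subset _ _, ?_⟩, ?_⟩
            · rw [Finset.card_erase_of_mem h1]; omega
            · exact Finset.subset_erase.2 ⟨hA.1, h2⟩
        rw [this, Finset.card_image_of_injOn, Finset.card_sdiff_of_subset hA.1]
        · omega
        · intro x hx y hy hxy
          simp only [Finset.coe_sdiff, Set.mem_sdiff, Finset.mem_coe] at hx hy
          by_contra hne
          have : x ∈ B.erase y := Finset.mem_erase.2 ⟨hne, hx.1⟩
          have hxy' : B.erase x = B.erase y := hxy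
          rw [← hxy'] at this
          simp at this
      · intro B' A
        simp only [Finset.mem_filter, Finset.mem_powersetCard]
        constructor
        · rintro ⟨⟨h1, h2⟩, h3, h4⟩
          exact ⟨⟨⟨h1, h2⟩, h3⟩, h3.trans h1, h4⟩
        · rintro ⟨⟨⟨h1, h2⟩, h3⟩, h4, h5⟩
          exact ⟨⟨h1, h2⟩, h3, h5⟩
    have h3 : ∀ A ⊆ U, A.card = s → u (insert z A) = 0 := by
      apply ih s (t+1) (fun A => u (insert z A)) (by omega) (by omega)
      intro B hB hBt
      have e : ∑ B' ∈ B.powersetCard t, (∑ A ∈ B'.powersetCard (s+1), u A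
          + ∑ A ∈ B'.powersetCard s, u (insert z A)) = 0 := by
        apply Finset.sum_eq_zero
        intro B' hB'
        rw [Finset.mem_powersetCard] at hB'
        exact h2 B' (hB'.1.trans hB) hB'.2
      rw [Finset.sum_add_distrib, dc (s+1) u B hBt (by omega),
        dc s (fun A => u (insert z A)) B hBt (by omega),
        h B (hB.trans (Finset.subset_insert _ _)) hBt, mul_zero, zero_add] at e
      rcases mul_eq_zero.1 e with e | e
      · exfalso
        have : t + 1 - s = 0 := by exact_mod_cast e
        omega
      · exact e
    have h4 : ∀ A ⊆ U, A.card = s + 1 → u A = 0 := by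
      apply ih (s+1) t u (by omega) (by omega)
      intro B hB hBt
      have := h2 B hB hBt
      rwa [Finset.sum_eq_zero (s := B.powersetCard s), add_zero] at this
      intro A hA
      rw [Finset.mem_powersetCard] at hA
      exact h3 A (hA.1.trans hB) hA.2
    by_cases hzA : z ∈ A
    · have := h3 (A.erase z) (by rwa [← Finset.subset_insert_iff])
        (by rw [Finset.card_erase_of_mem hzA]; omega)
      rwa [Finset.insert_erase hzA] at this
    · exact h4 A ((Finset.subset_insert_iff_of_notMem hzA).1 hA) hAs

noncomputable instance wrFintype (G : Type) [CommGroup G] [Fintype G] (n : ℕ) :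
    Fintype (Wr G n) :=
  Fintype.ofEquiv _ (SemidirectProduct.equivProd (φ := permMulAut G n)).symm

section tabs
variable {G : Type} [CommGroup G] {n : ℕ}

/-- Raw tabloids. -/
abbrev RT (G : Type) (n : ℕ) := (Fin n → ℕ ⊕ ℕ) × (Fin n → G)

/-- Tabloids whose block sizes are given by `β`. -/
def Tab (G : Type) [CommGroup G] (n : ℕ) (β : ℕ ⊕ ℕ → ℕ) : Set (RT G n) :=
  {T | (∀ x, (Finset.univ.filter (fun a => T.1 a = x)).card = β x) ∧
    ∀ a j, T.1 a = Sum.inr j → T.2 a = 1}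

/-- Block sizes of a double multiset. -/
def shp (σ ρ : Multiset ℕ) : ℕ ⊕ ℕ → ℕ := Sum.elim (dparts σ) (dparts ρ)

theorem isTabloid_iff (σ ρ : Multiset ℕ) (T : RT G n) :
    IsTabloid G n σ ρ T ↔ T ∈ Tab G n (shp σ ρ) := by
  unfold IsTabloid Tab shp
  simp only [Nat.card_eq_fintype_card, Fintype.card_subtype, Set.mem_ofPred_eq, Sum.forall,
    Sum.elim_inl, Sum.elim_inr, and_assoc]

theorem tabAct_mul (v w : Wr G n) (T : RT G n) :
    tabAct (v * w) T = tabAct v (tabAct w T) := by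
  unfold tabAct
  refine Prod.ext ?_ ?_
  · funext a
    simp
  · funext a
    simp only [SemidirectProduct.mul_right, mul_inv_rev, Equiv.Perm.mul_apply,
      SemidirectProduct.mul_left, Pi.mul_apply]
    cases h : T.1 (w.right⁻¹ (v.right⁻¹ a)) with
    | inl i =>
      simp only
      have : (permMulAut G n v.right) w.left a = w.left (v.right⁻¹ a) := rfl
      rw [this]
      rw [mul_assoc, mul_comm (v.left a)]
    | inr j => rfl

/-- Elementwise description of the action. -/
theorem tabAct_eq_iff (w : Wr G n) (a b : RT G n) (hb : ∀ z j, b.1 z = Sum.inr j → b.2 z = 1) :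
    tabAct w a = b ↔ ∀ z, b.1 (w.right z) = a.1 z ∧
      ∀ i, a.1 z = Sum.inl i → b.2 (w.right z) = a.2 z * w.left (w.right z) := by
  constructor
  · rintro rfl z
    unfold tabAct
    refine ⟨by simp, ?_⟩
    intro i hi
    simp [hi]
  · intro h
    refine Prod.ext ?_ ?_
    · funext x
      have := (h (w.right⁻¹ x)).1
      rw [show w.right (w.right⁻¹ x) = x from Equiv.apply_symm_apply w.right x] at this
      exact this.symm
    · funext x
      have := h (w.right⁻¹ x)
      rw [show w.right (w.right⁻¹ x) = x from Equiv.apply_symm_apply w.right x] at this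
      unfold tabAct
      simp only
      cases h : a.1 (w.right⁻¹ x) with
      | inl i => exact (this.2 i h).symm
      | inr j =>
        rw [h] at this
        exact (hb x j this.1).symm

theorem tabAct_mem {β : ℕ ⊕ ℕ → ℕ} (w : Wr G n) {a : RT G n} (ha : a ∈ Tab G n β) :
    tabAct w a ∈ Tab G n β := by
  refine ⟨?_, ?_⟩
  · intro x
    rw [← ha.1 x]
    refine Finset.card_bij' (fun z _ => w.right⁻¹ z) (fun z _ => w.right z) ?_ ?_ ?_ ?_
    · intro z hz
      rw [Finset.mem_filter] at hz ⊢
      exact ⟨Finset.mem_univ _, hz.2⟩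
    · intro z hz
      rw [Finset.mem_filter] at hz ⊢
      refine ⟨Finset.mem_univ _, ?_⟩
      simpa [tabAct] using hz.2
    · intro z _
      simp
    · intro z _
      simp
  · intro z j hz
    unfold tabAct at hz ⊢
    simp only at hz ⊢
    rw [hz]

/-- An underlying block permutation lifts to the wreath product. -/
theorem exists_lift {β : ℕ ⊕ ℕ → ℕ} {a b : RT G n} (hb : b ∈ Tab G n β)
    (π : Equiv.Perm (Fin n)) (h : ∀ z, b.1 (π z) = a.1 z) :
    ∃ w : Wr G n, w.right = π ∧ tabAct w a = b := by
  refine ⟨⟨fun z => b.2 z / a.2 (π⁻¹ z), π⟩, rfl, ?_⟩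
  rw [tabAct_eq_iff _ _ _ hb.2]
  intro z
  refine ⟨h z, ?_⟩
  intro i hi
  simp

theorem exists_perm {β : ℕ ⊕ ℕ → ℕ} {a b : RT G n} (ha : a ∈ Tab G n β) (hb : b ∈ Tab G n β) :
    ∃ π : Equiv.Perm (Fin n), ∀ z, b.1 (π z) = a.1 z := by
  have : ∀ x, Nonempty ({z // a.1 z = x} ≃ {z // b.1 z = x}) := by
    intro x
    rw [← Fintype.card_eq, Fintype.card_subtype, Fintype.card_subtype, ha.1, hb.1]
  have e := fun x => Classical.choice (this x)
  refine ⟨Equiv.ofFiberEquiv e, ?_⟩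
  intro z
  exact Equiv.ofFiberEquiv_map e z

theorem exists_act {β : ℕ ⊕ ℕ → ℕ} {a b : RT G n} (ha : a ∈ Tab G n β) (hb : b ∈ Tab G n β) :
    ∃ w : Wr G n, tabAct w a = b := by
  obtain ⟨π, hπ⟩ := exists_perm ha hb
  obtain ⟨w, _, hw⟩ := exists_lift hb π hπ
  exact ⟨w, hw⟩

open Classical in
/-- The number of elements of `Y` mapping `a` to `b`. -/
noncomputable def cnt [Fintype G] (Y : Set (Wr G n)) (a b : RT G n) : ℕ :=
  (Finset.univ.filter (fun y : Wr G n => y ∈ Y ∧ tabAct y a = b)).card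

variable [Fintype G]

theorem cnt_univ_le {β : ℕ ⊕ ℕ → ℕ} {a b a' b' : RT G n} (ha : a ∈ Tab G n β)
    (hb : b ∈ Tab G n β) (ha' : a' ∈ Tab G n β) (hb' : b' ∈ Tab G n β) :
    cnt Set.univ a b ≤ cnt Set.univ a' b' := by
  classical
  obtain ⟨v, hv⟩ := exists_act ha' ha
  obtain ⟨w, hw⟩ := exists_act hb hb'
  apply Finset.card_le_card_of_injOn (fun y => w * y * v)
  · intro y hy
    simp only [Set.mem_univ, true_and, Finset.coe_filter, Finset.mem_univ, Set.mem_ofPred_eq] at hy ⊢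
    rw [tabAct_mul, tabAct_mul, hv, hy, hw]
  · intro x _ y _ h
    simpa using h

theorem cnt_univ_const {β : ℕ ⊕ ℕ → ℕ} {a b a' b' : RT G n} (ha : a ∈ Tab G n β)
    (hb : b ∈ Tab G n β) (ha' : a' ∈ Tab G n β) (hb' : b' ∈ Tab G n β) :
    cnt Set.univ a b = cnt Set.univ a' b' :=
  le_antisymm (cnt_univ_le ha hb ha' hb') (cnt_univ_le ha' hb' ha hb)

theorem cnt_univ_pos {β : ℕ ⊕ ℕ → ℕ} {a b : RT G n} (ha : a ∈ Tab G n β)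
    (hb : b ∈ Tab G n β) : 0 < cnt Set.univ a b := by
  classical
  obtain ⟨v, hv⟩ := exists_act ha hb
  exact Finset.card_pos.2 ⟨v, by simp [hv]⟩

theorem dpt_iff (σ ρ : Multiset ℕ) (Y : Set (Wr G n)) :
    DPTransitive G n σ ρ Y ↔ ∃ c : ℕ, 0 < c ∧ ∀ a ∈ Tab G n (shp σ ρ),
      ∀ b ∈ Tab G n (shp σ ρ), cnt Y a b = c := by
  classical
  unfold DPTransitive IsTransitiveOn cnt
  simp only [Set.mem_ofPred_eq, isTabloid_iff, Nat.card_eq_fintype_card, Fintype.card_subtype]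
  
theorem dpt_of_mul (σ ρ : Multiset ℕ) (Y : Set (Wr G n)) (D : ℕ)
    (h : ∀ a ∈ Tab G n (shp σ ρ), ∀ b ∈ Tab G n (shp σ ρ), D * cnt Y a b = cnt Set.univ a b) :
    DPTransitive G n σ ρ Y := by
  rw [dpt_iff]
  by_cases hne : ∃ a, a ∈ Tab G n (shp σ ρ)
  · obtain ⟨a, ha⟩ := hne
    have h0 := h a ha a ha
    have hp := cnt_univ_pos ha ha
    rw [← h0] at hp
    refine ⟨cnt Y a a, Nat.pos_of_mul_pos_left hp, ?_⟩
    intro a' ha' b' hb'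
    have h1 := h a' ha' b' hb'
    rw [cnt_univ_const ha' hb' ha ha, ← h0] at h1
    exact Nat.eq_of_mul_eq_mul_left (Nat.pos_of_mul_pos_right hp) h1
  · refine ⟨1, one_pos, ?_⟩
    intro a ha
    exact (hne ⟨a, ha⟩).elim

end tabs

section nullity
variable {G : Type} [CommGroup G] {n : ℕ} [Fintype G]

open Classical in
/-- Weighted count of group elements mapping `a` to `b`. -/
noncomputable def wsum (F : Wr G n → ℚ) (a b : RT G n) : ℚ :=
  ∑ y, if tabAct y a = b then F y else 0

/-- `F` annihilates the tabloid module of shape `β`. -/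
def NullOn (β : ℕ ⊕ ℕ → ℕ) (F : Wr G n → ℚ) : Prop :=
  ∀ a ∈ Tab G n β, ∀ b ∈ Tab G n β, wsum F a b = 0

/-- The relation between a tabloid and a finer one. -/
def RelT (i J : ℕ ⊕ ℕ) (b c : RT G n) : Prop :=
  ∀ z, (b.1 z = c.1 z ∨ (c.1 z = J ∧ b.1 z = i)) ∧ ((b.1 z).isLeft = true → b.2 z = c.2 z)

/-- Normalise the colouring. -/
def nrm (f : Fin n → ℕ ⊕ ℕ) (h : Fin n → G) : RT G n :=
  (f, fun z => if (f z).isLeft = true then h z else 1)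

theorem null_sum {β : ℕ ⊕ ℕ → ℕ} {F : Wr G n → ℚ} (hF : NullOn β F) (P : RT G n → Prop)
    [DecidablePred P] {a : RT G n} (ha : a ∈ Tab G n β) :
    ∑ y, (if P (tabAct y a) then F y else 0) = 0 := by
  classical
  rw [← Finset.sum_fiberwise_of_maps_to (s := Finset.univ)
    (t := Finset.univ.image (fun y : Wr G n => tabAct y a)) (g := fun y => tabAct y a)
    (fun y _ => Finset.mem_image_of_mem _ (Finset.mem_univ y))]
  apply Finset.sum_eq_zero
  intro c hc
  rw [Finset.mem_image] at hc
  obtain ⟨w, _, rfl⟩ := hc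
  have h1 := hF a ha _ (tabAct_mem w ha)
  unfold wsum at h1
  rw [← Finset.sum_filter] at h1
  by_cases hP : P (tabAct w a)
  · rw [← h1]
    apply Finset.sum_congr rfl
    intro y hy
    rw [Finset.mem_filter] at hy
    rw [if_pos]
    rw [hy.2]; exact hP
  · apply Finset.sum_eq_zero
    intro y hy
    rw [Finset.mem_filter] at hy
    rw [if_neg]
    rw [hy.2]; exact hP

theorem null_step (β β' : ℕ ⊕ ℕ → ℕ) (i : ℕ ⊕ ℕ) (j : ℕ) (hij : i ≠ Sum.inl j)
    (h1 : β (Sum.inl j) ≤ β' (Sum.inl j)) (h2 : β (Sum.inl j) ≤ β' i)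
    (hsum : β i + β (Sum.inl j) = β' i + β' (Sum.inl j))
    (hoth : ∀ x, x ≠ i → x ≠ Sum.inl j → β x = β' x) (F : Wr G n → ℚ)
    (hF : NullOn β' F) : NullOn β F := by
  classical
  intro a ha b hb
  set J : ℕ ⊕ ℕ := Sum.inl j with hJ
  set U : Finset (Fin n) := Finset.univ.filter (fun z => a.1 z = i ∨ a.1 z = J) with hU
  have hUm : ∀ z, z ∈ U ↔ (a.1 z = i ∨ a.1 z = J) := by intro z; simp [hU]
  let blk : Finset (Fin n) → Fin n → ℕ ⊕ ℕ :=
    fun A z => if z ∈ U then (if z ∈ A then J else i) else a.1 z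
  have hUc : U.card = β i + β J := by
    rw [← ha.1 i, ← ha.1 J, hU, Finset.filter_or, Finset.card_union_of_disjoint]
    rw [Finset.disjoint_left]
    intro z h3 h4
    rw [Finset.mem_filter] at h3 h4
    exact hij (h3.2.symm.trans h4.2)
  -- the finer tabloids
  have hfine : ∀ B ⊆ U, B.card = β' J → nrm (blk B) a.2 ∈ Tab G n β' := by
    intro B hB hBc
    refine ⟨?_, ?_⟩
    · intro x
      change (Finset.univ.filter (fun z => blk B z = x)).card = β' x
      by_cases hxJ : x = J
      · rw [hxJ, ← hBc]
        congr 1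
        ext z
        simp only [Finset.mem_filter, Finset.mem_univ, true_and, blk]
        constructor
        · intro hz
          by_contra hzB
          rw [if_neg hzB] at hz
          by_cases hzU : z ∈ U
          · rw [if_pos hzU] at hz; exact hij hz
          · rw [if_neg hzU] at hz; exact hzU ((hUm z).2 (Or.inr hz))
        · intro hz
          rw [if_pos (hB hz), if_pos hz]
      by_cases hxi : x = i
      · have : (U \ B).card = β' i := by
          rw [Finset.card_sdiff_of_subset hB, hBc, hUc, hsum]; omega
        rw [hxi, ← this]
        congr 1
        ext z
        simp only [Finset.mem_filter, Finset.mem_univ, true_and, blk, Finset.mem_sdiff]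
        constructor
        · intro hz
          by_cases hzU : z ∈ U
          · rw [if_pos hzU] at hz
            refine ⟨hzU, fun hzB => ?_⟩
            rw [if_pos hzB] at hz; exact hij hz.symm
          · rw [if_neg hzU] at hz; exact (hzU ((hUm z).2 (Or.inl hz))).elim
        · rintro ⟨h3, h4⟩
          rw [if_pos h3, if_neg h4]
      · rw [← hoth x hxi hxJ, ← ha.1 x]
        congr 1
        ext z
        simp only [Finset.mem_filter, Finset.mem_univ, true_and, blk]
        by_cases hzU : z ∈ U
        · rw [if_pos hzU]
          constructor
          · intro hz
            split_ifs at hz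
            · exact (hxJ hz.symm).elim
            · exact (hxi hz.symm).elim
          · intro hz
            rcases (hUm z).1 hzU with h | h
            · exact (hxi (hz.symm.trans h)).elim
            · exact (hxJ (hz.symm.trans h)).elim
        · rw [if_neg hzU]
    · intro z k hz
      have hz' : blk B z = Sum.inr k := hz
      simp [nrm, hz']
  have key : ∀ A ⊆ U, A.card = β J → wsum F (nrm (blk A) a.2) b = 0 := by
    apply incl_inj U (β J) (β' J) (fun A => wsum F (nrm (blk A) a.2) b) h1
    · omega
    intro B hB hBc
    have e := null_sum hF (fun c => RelT i J b c) (hfine B hB hBc)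
    rw [← e]
    unfold wsum
    rw [Finset.sum_comm]
    apply Finset.sum_congr rfl
    intro y _
    have hact : ∀ A, tabAct y (nrm (blk A) a.2) = b ↔ ∀ z, b.1 (y.right z) = blk A z ∧
        ((b.1 (y.right z)).isLeft = true → b.2 (y.right z) = a.2 z * y.left (y.right z)) := by
      intro A
      rw [tabAct_eq_iff _ _ _ hb.2]
      apply forall_congr'
      intro z
      change (b.1 (y.right z) = blk A z ∧ (∀ i, blk A z = Sum.inl i →
        b.2 (y.right z) = (if (blk A z).isLeft = true then a.2 z else 1) * _)) ↔ _
      constructor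
      · rintro ⟨h3, h4⟩
        refine ⟨h3, fun hl => ?_⟩
        rw [h3] at hl
        obtain ⟨i', hi'⟩ := Sum.isLeft_iff.1 hl
        rw [h4 i' hi', if_pos hl]
      · rintro ⟨h3, h4⟩
        refine ⟨h3, fun i' hi' => ?_⟩
        have hl : (blk A z).isLeft = true := by rw [hi']; rfl
        rw [if_pos hl]
        apply h4
        rw [h3]; exact hl
    have hrel : RelT i J b (tabAct y (nrm (blk B) a.2)) ↔
        ∀ z, (b.1 (y.right z) = blk B z ∨ (blk B z = J ∧ b.1 (y.right z) = i)) ∧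
        ((b.1 (y.right z)).isLeft = true → b.2 (y.right z) = a.2 z * y.left (y.right z)) := by
      unfold RelT
      rw [← y.right.forall_congr_right]
      apply forall_congr'
      intro z
      have e1 : (tabAct y (nrm (blk B) a.2)).1 (y.right z) = blk B z := by
        simp [tabAct, nrm]
      rw [e1]
      apply and_congr_right
      intro h3
      apply imp_congr_right
      intro hl
      have hl' : (blk B z).isLeft = true := by
        rcases h3 with h3 | h3
        · rw [← h3]; exact hl
        · rw [h3.1]; rfl
      obtain ⟨i', hi'⟩ := Sum.isLeft_iff.1 hl'
      have e2 : (tabAct y (nrm (blk B) a.2)).2 (y.right z) = a.2 z * y.left (y.right z) := by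
        simp [tabAct, nrm, hi']
      rw [e2]
    by_cases hR : RelT i J b (tabAct y (nrm (blk B) a.2))
    · rw [if_pos hR]
      rw [hrel] at hR
      set A' := B.filter (fun z => b.1 (y.right z) = J) with hA'
      have hA'm : A' ∈ B.powersetCard (β J) := by
        rw [Finset.mem_powersetCard]
        refine ⟨Finset.filter_subset _ _, ?_⟩
        rw [← hb.1 J]
        refine Finset.card_bij (fun z _ => y.right z) ?_ ?_ ?_
        · intro z hz
          rw [Finset.mem_filter] at hz
          simp [hz.2]
        · intro z _ w _ h
          exact y.right.injective h
        · intro z hz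
          rw [Finset.mem_filter] at hz
          refine ⟨y.right.symm z, ?_, by simp⟩
          rw [hA', Finset.mem_filter]
          simp only [Equiv.apply_symm_apply]
          refine ⟨?_, hz.2⟩
          have := (hR (y.right.symm z)).1
          rw [Equiv.apply_symm_apply, hz.2] at this
          rcases this with h | h
          · simp only [blk] at h
            by_contra hzB
            rw [if_neg hzB] at h
            by_cases hzU : y.right.symm z ∈ U
            · rw [if_pos hzU] at h; exact hij h.symm
            · rw [if_neg hzU] at h; exact hzU ((hUm _).2 (Or.inr h.symm))
          · exact (hij h.2.symm).elim
      rw [Finset.sum_eq_single A']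
      · rw [if_pos]
        rw [hact]
        intro z
        refine ⟨?_, (hR z).2⟩
        have h3 := (hR z).1
        simp only [blk, hA', Finset.mem_filter] at h3 ⊢
        by_cases hzU : z ∈ U
        · by_cases hzB : z ∈ B
          · simp only [if_pos hzU, hzB, true_and, if_true] at h3 ⊢
            rcases h3 with h3 | h3
            · rw [if_pos h3, h3]
            · rw [h3, if_neg hij]
          · simp only [if_pos hzU, hzB, false_and, if_false] at h3 ⊢
            rcases h3 with h3 | h3
            · exact h3
            · exact h3.2
        · simp only [if_neg hzU] at h3 ⊢
          rcases h3 with h3 | h3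
          · exact h3
          · exact (hzU ((hUm z).2 (Or.inr h3.1))).elim
      · intro A hA hne
        rw [if_neg]
        intro hh
        rw [hact] at hh
        apply hne
        rw [Finset.mem_powersetCard] at hA
        ext z
        rw [hA', Finset.mem_filter, (hh z).1]
        constructor
        · intro hz
          refine ⟨hA.1 hz, ?_⟩
          simp only [blk]
          rw [if_pos (hB (hA.1 hz)), if_pos hz]
        · rintro ⟨h3, h4⟩
          simp only [blk] at h4
          by_contra hzA
          rw [if_pos (hB h3), if_neg hzA] at h4
          exact hij h4
      · intro h; exact (h hA'm).elim
    · rw [if_neg hR]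
      apply Finset.sum_eq_zero
      intro A hA
      rw [if_neg]
      intro hh
      apply hR
      rw [hact] at hh
      rw [hrel]
      intro z
      refine ⟨?_, (hh z).2⟩
      have h3 := (hh z).1
      rw [h3]
      rw [Finset.mem_powersetCard] at hA
      simp only [blk]
      by_cases hzU : z ∈ U
      · rw [if_pos hzU, if_pos hzU]
        by_cases hzA : z ∈ A
        · rw [if_pos hzA, if_pos (hA.1 hzA)]; left; rfl
        · rw [if_neg hzA]
          by_cases hzB : z ∈ B
          · right; rw [if_pos hzB]; exact ⟨rfl, rfl⟩
          · left; rw [if_neg hzB]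
      · rw [if_neg hzU, if_neg hzU]; left; rfl
  have hfin := key (Finset.univ.filter (fun z => a.1 z = J))
    (by intro z hz; rw [Finset.mem_filter] at hz; exact (hUm z).2 (Or.inr hz.2)) (ha.1 J)
  have ea : nrm (blk (Finset.univ.filter (fun z => a.1 z = J))) a.2 = a := by
    have e1 : blk (Finset.univ.filter (fun z => a.1 z = J)) = a.1 := by
      funext z
      simp only [blk, Finset.mem_filter, Finset.mem_univ, true_and]
      by_cases hzU : z ∈ U
      · rw [if_pos hzU]
        split_ifs with h
        · exact h.symm
        · rcases (hUm z).1 hzU with h3 | h3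
          · exact h3.symm
          · exact (h h3).elim
      · rw [if_neg hzU]
    rw [e1]
    refine Prod.ext rfl ?_
    funext z
    change (if (a.1 z).isLeft = true then a.2 z else 1) = a.2 z
    cases h : a.1 z with
    | inl i => simp
    | inr k => simp [ha.2 z k h]
  rwa [ea] at hfin

end nullity

section major

/-- The majorisation functional. -/
def phi (S : Finset (ℕ ⊕ ℕ)) (α : ℕ ⊕ ℕ → ℕ) (r : ℕ) : ℕ := ∑ x ∈ S, (α x - r)

theorem cvx_le (q s t a : ℕ) :
    (s + t) * (a - (q + s)) ≤ t * (a - q) + s * (a - (q + s + t)) := by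
  rcases le_total a (q + s) with h | h
  · rw [Nat.sub_eq_zero_of_le h]; simp
  obtain ⟨m, rfl⟩ := Nat.exists_eq_add_of_le h
  rw [show q + s + m - (q + s) = m by omega, show q + s + m - q = s + m by omega,
    show q + s + m - (q + s + t) = m - t by omega]
  rcases le_total m t with h' | h'
  · rw [Nat.sub_eq_zero_of_le h']
    nlinarith
  · obtain ⟨p, rfl⟩ := Nat.exists_eq_add_of_le h'
    rw [show t + p - t = p by omega]
    nlinarith

theorem cvx_lt (q s t a : ℕ) (hs : 0 < s) (ht : 0 < t) (h1 : q < a) (h2 : a < q + s + t) :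
    (s + t) * (a - (q + s)) < t * (a - q) + s * (a - (q + s + t)) := by
  rcases le_total a (q + s) with h | h
  · rw [Nat.sub_eq_zero_of_le h]
    have : 0 < t * (a - q) := Nat.mul_pos ht (by omega)
    omega
  obtain ⟨m, rfl⟩ := Nat.exists_eq_add_of_le h
  rw [show q + s + m - (q + s) = m by omega, show q + s + m - q = s + m by omega,
    show q + s + m - (q + s + t) = m - t by omega]
  have h' : m < t := by omega
  rw [Nat.sub_eq_zero_of_le h'.le]
  nlinarith

theorem cvx_eq (q s t a : ℕ) (h : a ≤ q ∨ q + s + t ≤ a) :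
    (s + t) * (a - (q + s)) = t * (a - q) + s * (a - (q + s + t)) := by
  rcases h with h | h
  · rw [Nat.sub_eq_zero_of_le h, Nat.sub_eq_zero_of_le (by omega : a ≤ q + s),
      Nat.sub_eq_zero_of_le (by omega : a ≤ q + s + t)]
    simp
  · obtain ⟨m, rfl⟩ := Nat.exists_eq_add_of_le h
    rw [show q + s + t + m - (q + s) = t + m by omega, show q + s + t + m - q = s + t + m by omega,
      show q + s + t + m - (q + s + t) = m by omega]
    ring

theorem phi_strict (S : Finset (ℕ ⊕ ℕ)) (α β : ℕ ⊕ ℕ → ℕ) (i : ℕ ⊕ ℕ) (hi : i ∈ S) (q ℓ r : ℕ)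
    (hle : ∀ r, phi S α r ≤ phi S β r) (hqr : q < r) (hrl : r < ℓ) (h1 : q < α i) (h2 : α i < ℓ)
    (hgap : ∀ x ∈ S, β x ≤ q ∨ ℓ ≤ β x) : phi S α r < phi S β r := by
  obtain ⟨s, rfl⟩ := Nat.exists_eq_add_of_lt hqr
  obtain ⟨t, rfl⟩ := Nat.exists_eq_add_of_lt hrl
  set s' := s + 1 with hs'
  set t' := t + 1 with ht'
  have e1 : q + s + 1 = q + s' := by omega
  have e2 : q + s + 1 + t + 1 = q + s' + t' := by omega
  rw [e1]
  rw [e2] at h2 hgap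
  have hα : (s' + t') * phi S α (q + s') < t' * phi S α q + s' * phi S α (q + s' + t') := by
    unfold phi
    rw [Finset.mul_sum, Finset.mul_sum, Finset.mul_sum, ← Finset.sum_add_distrib]
    apply Finset.sum_lt_sum
    · intro x _; exact cvx_le _ _ _ _
    · exact ⟨i, hi, cvx_lt _ _ _ _ (by omega) (by omega) h1 h2⟩
  have hβ : (s' + t') * phi S β (q + s') = t' * phi S β q + s' * phi S β (q + s' + t') := by
    unfold phi
    rw [Finset.mul_sum, Finset.mul_sum, Finset.mul_sum, ← Finset.sum_add_distrib]
    apply Finset.sum_congr rfl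
    intro x hx; exact cvx_eq _ _ _ _ (hgap x hx)
  have h3 := Nat.mul_le_mul_left t' (hle q)
  have h4 := Nat.mul_le_mul_left s' (hle (q + s' + t'))
  have h5 : (s' + t') * phi S α (q + s') < (s' + t') * phi S β (q + s') := by omega
  exact Nat.lt_of_mul_lt_mul_left h5

theorem phi_split (S : Finset (ℕ ⊕ ℕ)) (i j : ℕ ⊕ ℕ) (hi : i ∈ S) (hj : j ∈ S) (hij : i ≠ j)
    (β : ℕ ⊕ ℕ → ℕ) (r : ℕ) :
    phi S β r = (β i - r) + ((β j - r) + phi ((S.erase i).erase j) β r) := by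
  unfold phi
  rw [← Finset.add_sum_erase S _ hi, ← Finset.add_sum_erase (S.erase i) _
    (Finset.mem_erase.2 ⟨hij.symm, hj⟩)]

variable {G : Type} [CommGroup G] {n : ℕ} [Fintype G]

theorem lower (S : Finset (ℕ ⊕ ℕ)) (i : ℕ ⊕ ℕ) (hi : i ∈ S)
    (hS : ∀ x ∈ S, x ≠ i → ∃ j, x = Sum.inl j) (α : ℕ ⊕ ℕ → ℕ) :
    ∀ (N : ℕ) (β : ℕ ⊕ ℕ → ℕ), β i = N → α i ≤ β i → (∀ r, phi S α r ≤ phi S β r) →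
      phi S α 0 = phi S β 0 →
      ∃ β' : ℕ ⊕ ℕ → ℕ, (∀ F : Wr G n → ℚ, NullOn β' F → NullOn β F) ∧ β' i = α i ∧
        (∀ r, phi S α r ≤ phi S β' r) ∧ phi S α 0 = phi S β' 0 ∧ ∀ x, x ∉ S → β' x = β x := by
  intro N
  induction N using Nat.strong_induction_on with
  | _ N ih =>
  intro β hN hle hphi h0
  rcases hle.eq_or_lt with heq | hlt
  · exact ⟨β, fun F h => h, heq.symm, hphi, h0, fun x _ => rfl⟩
  have hT : (S.filter (fun x => β x < β i)).Nonempty := by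
    by_contra hne
    rw [Finset.not_nonempty_iff_eq_empty, Finset.filter_eq_empty_iff] at hne
    have e1 : phi S β 0 = phi S β (β i) + ∑ x ∈ S, β i := by
      unfold phi
      rw [← Finset.sum_add_distrib]
      apply Finset.sum_congr rfl
      intro x hx
      have := hne hx
      omega
    have e2 : phi S α 0 < phi S α (β i) + ∑ x ∈ S, β i := by
      unfold phi
      rw [← Finset.sum_add_distrib]
      apply Finset.sum_lt_sum
      · intro x hx; omega
      · exact ⟨i, hi, by omega⟩
    have := hphi (β i)
    omega
  obtain ⟨x0, hx0, hmax⟩ := Finset.exists_max_image _ β hT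
  rw [Finset.mem_filter] at hx0
  have hxi : i ≠ x0 := by rintro rfl; exact lt_irrefl _ hx0.2
  have hgap : ∀ x ∈ S, β x ≤ β x0 ∨ β i ≤ β x := by
    intro x hx
    by_cases h : β x < β i
    · exact Or.inl (hmax x (Finset.mem_filter.2 ⟨hx, h⟩))
    · exact Or.inr (not_lt.1 h)
  obtain ⟨j, hj⟩ := hS x0 hx0.1 hxi.symm
  -- generic replacement
  have gen : ∀ u v : ℕ, β x0 ≤ u → β x0 ≤ v → u + v = β i + β x0 → u < β i → α i ≤ u →
      (∀ r, phi S α r + ((β i - r) + (β x0 - r)) ≤ phi S β r + ((u - r) + (v - r))) →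
      ∃ β' : ℕ ⊕ ℕ → ℕ, (∀ F : Wr G n → ℚ, NullOn β' F → NullOn β F) ∧ β' i = α i ∧
        (∀ r, phi S α r ≤ phi S β' r) ∧ phi S α 0 = phi S β' 0 ∧ ∀ x, x ∉ S → β' x = β x := by
    intro u v hu hv huv hui hau hph
    let γ : ℕ ⊕ ℕ → ℕ := fun x => if x = i then u else if x = x0 then v else β x
    have gi : γ i = u := by simp [γ]
    have gx : γ x0 = v := by simp [γ, hxi.symm]
    have go : ∀ x, x ≠ i → x ≠ x0 → γ x = β x := by
      intro x h1 h2; simp [γ, h1, h2]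
    have gphi : ∀ r, phi S γ r + ((β i - r) + (β x0 - r)) = phi S β r + ((u - r) + (v - r)) := by
      intro r
      rw [phi_split S i x0 hi hx0.1 hxi γ, phi_split S i x0 hi hx0.1 hxi β, gi, gx]
      have : phi ((S.erase i).erase x0) γ r = phi ((S.erase i).erase x0) β r := by
        unfold phi
        apply Finset.sum_congr rfl
        intro x hx
        rw [Finset.mem_erase, Finset.mem_erase] at hx
        rw [go x hx.2.1 hx.1]
      omega
    obtain ⟨β', h1, h2, h3, h4, h5⟩ := ih u (by omega) γ gi (by omega)
      (by intro r; have := hph r; have := gphi r; omega)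
      (by have := gphi 0; omega)
    refine ⟨β', ?_, h2, h3, h4, ?_⟩
    · intro F hF
      refine null_step β γ i j (by rw [← hj]; exact hxi) ?_ ?_ ?_ ?_ F (h1 F hF)
      · rw [← hj, gx]; exact hv
      · rw [← hj, gi]; exact hu
      · rw [← hj, gi, gx]; omega
      · intro x h6 h7
        rw [← hj] at h7
        exact (go x h6 h7).symm
    · intro x hx
      rw [h5 x hx]
      apply go
      · rintro rfl; exact hx hi
      · rintro rfl; exact hx hx0.1
  rcases le_or_gt (α i) (β x0) with hc | hc
  · apply gen (β x0) (β i) le_rfl hx0.2.le (by omega) hx0.2 hc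
    intro r
    have := hphi r
    omega
  · apply gen (β i - 1) (β x0 + 1) (by omega) (by omega) (by omega) (by omega) (by omega)
    intro r
    have := hphi r
    by_cases hr : β x0 < r ∧ r < β i
    · have := phi_strict S α β i hi (β x0) (β i) r hphi hr.1 hr.2 hc hlt hgap
      omega
    · omega

theorem lower_all (α : ℕ ⊕ ℕ → ℕ) (N : ℕ) :
    ∀ (S : Finset (ℕ ⊕ ℕ)) (β : ℕ ⊕ ℕ → ℕ), S.card = N → (∀ x ∈ S, ∃ j, x = Sum.inl j) →
      (∀ r, phi S α r ≤ phi S β r) →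
      phi S α 0 = phi S β 0 → (∀ x, x ∉ S → β x = α x) →
      ∀ F : Wr G n → ℚ, NullOn α F → NullOn β F := by
  induction N with
  | zero =>
    intro S β hS _ _ _ hoff F hF
    rw [Finset.card_eq_zero] at hS
    subst hS
    have : β = α := by funext x; exact hoff x (Finset.notMem_empty x)
    rwa [this]
  | succ N ih =>
    intro S β hS hl hphi h0 hoff F hF
    have hne : S.Nonempty := by rw [← Finset.card_pos]; omega
    obtain ⟨i, hi, hle⟩ : ∃ i ∈ S, α i ≤ β i := by
      apply Finset.exists_le_of_sum_le hne
      have := hphi 0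
      simpa [phi] using this
    obtain ⟨β', h1, h2, h3, h4, h5⟩ := lower (G := G) (n := n) S i hi (fun x hx _ => hl x hx) α _ β
      rfl hle hphi h0
    apply h1
    have er : ∀ (γ : ℕ ⊕ ℕ → ℕ) r, phi S γ r = (γ i - r) + phi (S.erase i) γ r := by
      intro γ r
      exact (Finset.add_sum_erase S (fun x => γ x - r) hi).symm
    apply ih (S.erase i) β' (by rw [Finset.card_erase_of_mem hi]; omega)
      (fun x hx => hl x (Finset.mem_of_mem_erase hx)) _ _ _ F hF
    · intro r
      have := h3 r
      rw [er, er, h2] at this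
      omega
    · rw [er, er β', h2] at h4
      omega
    · intro x hx
      by_cases hxi : x = i
      · rw [hxi, h2]
      · have : x ∉ S := fun h => hx (Finset.mem_erase.2 ⟨hxi, h⟩)
        rw [h5 x this, hoff x this]

theorem null_of_major (S : Finset (ℕ ⊕ ℕ)) (i : ℕ ⊕ ℕ) (hi : i ∈ S)
    (hS : ∀ x ∈ S, x ≠ i → ∃ j, x = Sum.inl j) (α β : ℕ ⊕ ℕ → ℕ) (hle : α i ≤ β i)
    (hphi : ∀ r, phi S α r ≤ phi S β r) (h0 : phi S α 0 = phi S β 0)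
    (hoff : ∀ x, x ∉ S → β x = α x) (F : Wr G n → ℚ) (hF : NullOn α F) : NullOn β F := by
  obtain ⟨β', h1, h2, h3, h4, h5⟩ := lower (G := G) (n := n) S i hi hS α _ β rfl hle hphi h0
  apply h1
  have er : ∀ (γ : ℕ ⊕ ℕ → ℕ) r, phi S γ r = (γ i - r) + phi (S.erase i) γ r := by
    intro γ r
    exact (Finset.add_sum_erase S (fun x => γ x - r) hi).symm
  apply lower_all α _ (S.erase i) β' rfl _ _ _ _ F hF
  · intro x hx
    rw [Finset.mem_erase] at hx
    exact hS x hx.2 hx.1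
  · intro r
    have := h3 r
    rw [er, er, h2] at this
    omega
  · rw [er, er β', h2] at h4
    omega
  · intro x hx
    by_cases hxi : x = i
    · rw [hxi, h2]
    · have : x ∉ S := fun h => hx (Finset.mem_erase.2 ⟨hxi, h⟩)
      rw [h5 x this, hoff x this]

open Classical in
theorem dpt_of_null (σ ρ τ π : Multiset ℕ) (hne : ∃ a, a ∈ Tab G n (shp σ ρ))
    (h : ∀ F : Wr G n → ℚ, NullOn (shp σ ρ) F → NullOn (shp τ π) F) :
    DPDom G n σ ρ τ π := by
  intro Y hY
  rw [dpt_iff] at hY ⊢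
  obtain ⟨c, hc, hY⟩ := hY
  obtain ⟨a0, ha0⟩ := hne
  -- the scaled identity
  have hw : ∀ (Z : Set (Wr G n)) (a b : RT G n) ,
      wsum (fun y => if y ∈ Z then (1 : ℚ) else 0) a b = cnt Z a b := by
    intro Z a b
    unfold wsum cnt
    rw [Finset.card_filter]
    push_cast
    apply Finset.sum_congr rfl
    intro y _
    by_cases h1 : tabAct y a = b <;> by_cases h2 : y ∈ Z <;> simp [h1, h2]
  obtain ⟨D, hD⟩ : ∃ D, D = cnt (G := G) (n := n) Set.univ a0 a0 := ⟨_, rfl⟩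
  have hDp : 0 < D := hD ▸ cnt_univ_pos ha0 ha0
  let F : Wr G n → ℚ := fun y => D * (if y ∈ Y then (1 : ℚ) else 0) -
    c * (if y ∈ (Set.univ : Set (Wr G n)) then (1 : ℚ) else 0)
  have hFw : ∀ a b, wsum F a b = D * cnt Y a b - c * cnt Set.univ a b := by
    intro a b
    rw [← hw Y a b, ← hw Set.univ a b]
    unfold wsum
    rw [Finset.mul_sum, Finset.mul_sum, ← Finset.sum_sub_distrib]
    apply Finset.sum_congr rfl
    intro y _
    by_cases h1 : tabAct y a = b <;> simp [h1, F]
  have hF : NullOn (shp σ ρ) F := by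
    intro a ha b hb
    rw [hFw, hY a ha b hb, cnt_univ_const ha hb ha0 ha0, ← hD]
    ring
  have hF2 := h F hF
  by_cases hne2 : ∃ b, b ∈ Tab G n (shp τ π)
  · obtain ⟨b0, hb0⟩ := hne2
    have hval : ∀ a ∈ Tab G n (shp τ π), ∀ b ∈ Tab G n (shp τ π),
        D * cnt Y a b = c * cnt Set.univ b0 b0 := by
      intro a ha b hb
      have := hF2 a ha b hb
      rw [hFw, cnt_univ_const ha hb hb0 hb0, sub_eq_zero] at this
      exact_mod_cast this
    refine ⟨cnt Y b0 b0, ?_, ?_⟩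
    · have h1 := hval b0 hb0 b0 hb0
      have h2 : 0 < c * cnt (G := G) (n := n) Set.univ b0 b0 :=
        Nat.mul_pos hc (cnt_univ_pos hb0 hb0)
      rw [← h1] at h2
      exact Nat.pos_of_mul_pos_left h2
    · intro a ha b hb
      have h1 := hval b0 hb0 b0 hb0
      rw [← hval a ha b hb] at h1
      exact (Nat.eq_of_mul_eq_mul_left hDp h1).symm
  · exact ⟨1, one_pos, fun a ha => (hne2 ⟨a, ha⟩).elim⟩

end major

section lists

theorem list_getD_sum (f : ℕ → ℕ) (hf : f 0 = 0) : ∀ (L : List ℕ) (m : ℕ), L.length ≤ m →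
    ∑ i ∈ Finset.range m, f (L.getD i 0) = (L.map f).sum := by
  intro L
  induction L with
  | nil => intro m _; simp [hf]
  | cons a L ih =>
    intro m hm
    obtain ⟨m, rfl⟩ : ∃ m', m = m' + 1 := ⟨m - 1, by simp at hm; omega⟩
    rw [Finset.sum_range_succ']
    simp only [List.getD_cons_succ, List.getD_cons_zero, List.map_cons, List.sum_cons]
    rw [ih m (by simpa using hm)]
    ring

theorem sum_small (r : ℕ) (L : List ℕ) (h : ∀ x ∈ L, x ≤ r) : (L.map (· - r)).sum = 0 := by
  rw [List.sum_eq_zero]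
  intro x hx
  rw [List.mem_map] at hx
  obtain ⟨y, hy, rfl⟩ := hx
  have := h y hy
  omega

theorem take_le (r : ℕ) : ∀ (L : List ℕ) (K : ℕ),
    (L.take K).sum ≤ (L.map (· - r)).sum + r * K := by
  intro L
  induction L with
  | nil => intro K; simp
  | cons a L ih =>
    intro K
    cases K with
    | zero => simp
    | succ K =>
      have := ih K
      simp only [List.take_succ_cons, List.sum_cons, List.map_cons, Nat.mul_succ]
      omega

theorem take_ex (r : ℕ) : ∀ (L : List ℕ), L.Pairwise (· ≥ ·) →
    ∃ K, (L.map (· - r)).sum + r * K = (L.take K).sum := by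
  intro L
  induction L with
  | nil => intro _; exact ⟨0, by simp⟩
  | cons a L ih =>
    intro h
    rw [List.pairwise_cons] at h
    by_cases har : a ≤ r
    · refine ⟨0, ?_⟩
      rw [sum_small r (a :: L)]
      · simp
      · intro x hx
        rcases List.mem_cons.1 hx with rfl | hx
        · exact har
        · exact (h.1 x hx).trans har
    · obtain ⟨K, hK⟩ := ih h.2
      refine ⟨K + 1, ?_⟩
      simp only [List.take_succ_cons, List.sum_cons, List.map_cons, Nat.mul_succ]
      omega

theorem take_eq' : ∀ (L : List ℕ) (K : ℕ), L.Pairwise (· ≥ ·) →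
    (L.map (· - L.getD K 0)).sum + L.getD K 0 * K = (L.take K).sum := by
  intro L
  induction L with
  | nil => intro K _; simp
  | cons a L ih =>
    intro K h
    rw [List.pairwise_cons] at h
    cases K with
    | zero =>
      simp only [List.getD_cons_zero, List.take_zero, List.sum_nil, Nat.mul_zero, Nat.add_zero]
      apply sum_small
      intro x hx
      rcases List.mem_cons.1 hx with rfl | hx
      · exact le_rfl
      · exact h.1 x hx
    | succ K =>
      have := ih K h.2
      simp only [List.getD_cons_succ, List.take_succ_cons, List.sum_cons, List.map_cons,
        Nat.mul_succ]
      have h2 : L.getD K 0 ≤ a := by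
        by_cases hK : K < L.length
        · rw [List.getD_eq_getElem _ _ hK]
          exact h.1 _ (List.getElem_mem hK)
        · rw [List.getD_eq_default _ _ (not_lt.1 hK)]; omega
      omega

theorem desc_pairwise (s : Multiset ℕ) : ((s.sort (· ≤ ·)).reverse).Pairwise (· ≥ ·) := by
  rw [List.pairwise_reverse]
  exact Multiset.pairwise_sort s (· ≤ ·)

theorem desc_map_sum (s : Multiset ℕ) (f : ℕ → ℕ) :
    (((s.sort (· ≤ ·)).reverse).map f).sum = (s.map f).sum := by
  have h : (s.map f).sum = (((s.sort (· ≤ ·)) : Multiset ℕ).map f).sum := by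
    rw [Multiset.sort_eq]
  rw [h, Multiset.map_coe, Multiset.sum_coe, List.map_reverse, List.sum_reverse]

theorem msDom_iff (s t : Multiset ℕ) :
    msDom s t ↔ ∀ r, (s.map (· - r)).sum ≤ (t.map (· - r)).sum := by
  unfold msDom
  constructor
  · intro h r
    rw [← desc_map_sum, ← desc_map_sum]
    obtain ⟨K, hK⟩ := take_ex r _ (desc_pairwise s)
    have h1 := h K
    have h2 := take_le r ((t.sort (· ≤ ·)).reverse) K
    omega
  · intro h K
    have h1 := take_eq' _ K (desc_pairwise t)
    generalize ((t.sort (· ≤ ·)).reverse).getD K 0 = r at h1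
    have h2 := take_le r ((s.sort (· ≤ ·)).reverse) K
    have h3 := h r
    rw [← desc_map_sum, ← desc_map_sum] at h3
    omega

/-- The index set used for shapes. -/
def idx (m : ℕ) : Finset (ℕ ⊕ ℕ) := insert (Sum.inr 0) ((Finset.range m).image Sum.inl)

theorem idx_sum (m : ℕ) (f : ℕ ⊕ ℕ → ℕ) :
    ∑ x ∈ idx m, f x = f (Sum.inr 0) + ∑ i ∈ Finset.range m, f (Sum.inl i) := by
  unfold idx
  rw [Finset.sum_insert (by simp), Finset.sum_image]
  intro x _ y _ h
  exact Sum.inl.inj h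

theorem dparts_single (k : ℕ) : dparts {k} 0 = k := by
  simp [dparts]

theorem shp_sum (σ : Multiset ℕ) (k m : ℕ) (hm : σ.card ≤ m) (f : ℕ → ℕ) (hf : f 0 = 0) :
    ∑ x ∈ idx m, f (shp σ {k} x) = ((σ + {k}).map f).sum := by
  rw [idx_sum]
  simp only [shp, Sum.elim_inl, Sum.elim_inr, dparts_single]
  unfold dparts
  rw [list_getD_sum f hf _ m (by simpa using hm), desc_map_sum]
  simp [add_comm]

theorem phi_shp (σ : Multiset ℕ) (k m : ℕ) (hm : σ.card ≤ m) (r : ℕ) :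
    phi (idx m) (shp σ {k}) r = ((σ + {k}).map (· - r)).sum :=
  shp_sum σ k m hm (· - r) (by simp)

theorem shp_off (σ : Multiset ℕ) (k m : ℕ) (hm : σ.card ≤ m) (x : ℕ ⊕ ℕ) (hx : x ∉ idx m) :
    shp σ {k} x = 0 := by
  cases x with
  | inl i =>
    have : m ≤ i := by
      by_contra h
      apply hx
      simp [idx]; omega
    simp only [shp, Sum.elim_inl, dparts]
    apply List.getD_eq_default
    simp; omega
  | inr j =>
    have : 1 ≤ j := by
      by_contra h
      apply hx
      have : j = 0 := by omega
      simp [idx, this]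
    simp only [shp, Sum.elim_inr, dparts]
    apply List.getD_eq_default
    simp; omega

theorem exists_young (n : ℕ) (β : ℕ ⊕ ℕ → ℕ) (S : Finset (ℕ ⊕ ℕ)) (hoff : ∀ x, x ∉ S → β x = 0)
    (hsum : ∑ x ∈ S, β x = n) :
    ∃ (r : Fin n → ℕ ⊕ ℕ) (c : Fin n → ℕ),
      (∀ x, (Finset.univ.filter (fun z => r z = x)).card = β x) ∧
      (∀ z w, r z = r w → c z = c w → z = w) ∧ (∀ z, c z < β (r z)) := by
  have hc : Fintype.card (Σ x : S, Fin (β x.1)) = Fintype.card (Fin n) := by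
    rw [Fintype.card_sigma, Fintype.card_fin]
    simp only [Fintype.card_fin]
    rw [Finset.sum_coe_sort S β, hsum]
  obtain ⟨e⟩ := Fintype.card_eq.1 hc
  refine ⟨fun z => (e.symm z).1.1, fun z => (e.symm z).2.1, ?_, ?_, ?_⟩
  · intro x
    by_cases hx : x ∈ S
    · rw [← Fintype.card_fin (β x), ← Finset.card_univ]
      symm
      refine Finset.card_bij (fun p _ => e ⟨⟨x, hx⟩, p⟩) ?_ ?_ ?_
      · intro p _; simp
      · intro p _ q _ h
        simpa using h
      · intro z hz
        rw [Finset.mem_filter] at hz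
        obtain ⟨p, rfl⟩ := e.surjective z
        obtain ⟨⟨y, hy⟩, p⟩ := p
        have : y = x := by simpa using hz.2
        subst this
        exact ⟨p, Finset.mem_univ _, rfl⟩
    · rw [hoff x hx, Finset.card_eq_zero, Finset.filter_eq_empty_iff]
      intro z _ h
      exact hx (h ▸ (e.symm z).1.2)
  · intro z w h1 h2
    apply e.symm.injective
    have h3 : (e.symm z).1 = (e.symm w).1 := Subtype.ext h1
    change ((e.symm z).2 : ℕ) = ((e.symm w).2 : ℕ) at h2
    clear h1
    generalize e.symm z = p at *
    generalize e.symm w = q at *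
    obtain ⟨p1, p2⟩ := p
    obtain ⟨q1, q2⟩ := q
    simp only at h3
    subst h3
    congr 1
    exact Fin.ext h2
  · intro z
    exact (e.symm z).2.2

theorem exists_collision {n : ℕ} {α β : ℕ ⊕ ℕ → ℕ} {S : Finset (ℕ ⊕ ℕ)}
    {r b : Fin n → ℕ ⊕ ℕ} {c : Fin n → ℕ} (q : ℕ) (hq : phi S β q < phi S α q)
    (hoff : ∀ x, x ∉ S → β x = 0)
    (hr : ∀ z w, r z = r w → c z = c w → z = w) (hc : ∀ z, c z < β (r z))
    (hb : ∀ x, (Finset.univ.filter (fun z => b z = x)).card = α x) :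
    ∃ x y, x ≠ y ∧ c x = c y ∧ b x = b y := by
  by_contra hcon
  push Not at hcon
  have hbc : ∀ z w, b z = b w → c z = c w → z = w := by
    intro z w h1 h2
    by_contra hne
    exact hcon z w hne h2 h1
  apply absurd hq
  rw [not_lt]
  calc phi S α q ≤ ∑ x ∈ S, ((Finset.univ.filter (fun z => q ≤ c z)).filter
          (fun z => b z = x)).card := by
        apply Finset.sum_le_sum
        intro x _
        rw [← hb x]
        have h1 := Finset.card_filter_add_card_filter_not
          (s := Finset.univ.filter (fun z => b z = x)) (fun z => q ≤ c z)
        have h2 : ((Finset.univ.filter (fun z => b z = x)).filter (fun z => ¬ q ≤ c z)).card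
            ≤ (Finset.range q).card := by
          apply Finset.card_le_card_of_injOn c
          · intro z hz
            simp at hz ⊢
            exact hz.2
          · intro z hz w hw h
            simp at hz hw
            exact hbc z w (hz.1.trans hw.1.symm) h
        rw [Finset.card_range] at h2
        rw [Finset.filter_comm]
        omega
    _ ≤ (Finset.univ.filter (fun z => q ≤ c z)).card := by
        rw [← Finset.card_biUnion]
        · apply Finset.card_le_card
          intro z hz
          rw [Finset.mem_biUnion] at hz
          obtain ⟨x, _, hz⟩ := hz
          exact (Finset.mem_filter.1 hz).1
        · intro x _ y _ hxy
          rw [Function.onFun, Finset.disjoint_left]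
          intro z h1 h2
          rw [Finset.mem_filter] at h1 h2
          exact hxy (h1.2.symm.trans h2.2)
    _ = ∑ x ∈ S, ((Finset.univ.filter (fun z => q ≤ c z)).filter (fun z => r z = x)).card := by
        apply Finset.card_eq_sum_card_fiberwise
        intro z _
        by_contra h
        have := hc z
        rw [hoff _ h] at this
        omega
    _ ≤ phi S β q := by
        apply Finset.sum_le_sum
        intro x _
        rw [← Nat.card_Ico]
        apply Finset.card_le_card_of_injOn c
        · intro z hz
          simp at hz ⊢
          refine ⟨hz.1, ?_⟩
          rw [← hz.2]; exact hc z
        · intro z hz w hw h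
          simp at hz hw
          exact hr z w (hz.2.trans hw.2.symm) h

end lists

section constructions
variable {G : Type} [CommGroup G] {n : ℕ} [Fintype G]

theorem tab_of_blocks {β : ℕ ⊕ ℕ → ℕ} {r : Fin n → ℕ ⊕ ℕ}
    (hr : ∀ x, (Finset.univ.filter (fun z => r z = x)).card = β x) :
    ((r, fun _ => 1) : RT G n) ∈ Tab G n β :=
  ⟨hr, fun _ _ _ => rfl⟩

theorem cnt_le_of_mul (w : Wr G n) (Y Z : Set (Wr G n)) (a b b' : RT G n)
    (hw : tabAct w b = b') (h : ∀ y ∈ Y, w * y ∈ Z) : cnt Y a b ≤ cnt Z a b' := by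
  classical
  apply Finset.card_le_card_of_injOn (fun y => w * y)
  · intro y hy
    simp only [Finset.coe_filter, Finset.mem_univ, true_and, Set.mem_ofPred_eq] at hy ⊢
    exact ⟨h y hy.1, by rw [tabAct_mul, hy.2, hw]⟩
  · intro x _ y _ h
    simpa using h

theorem cnt_compl (Y : Set (Wr G n)) (a b : RT G n) :
    cnt Y a b + cnt Yᶜ a b = cnt Set.univ a b := by
  classical
  unfold cnt
  rw [← Finset.card_union_of_disjoint]
  · congr 1
    ext y
    simp only [Finset.mem_union, Finset.mem_filter, Finset.mem_univ, true_and, Set.mem_compl_iff,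
      Set.mem_univ]
    tauto
  · rw [Finset.disjoint_left]
    intro y h1 h2
    simp only [Finset.mem_filter, Finset.mem_univ, true_and, Set.mem_compl_iff] at h1 h2
    exact h2.1 h1.1

theorem cnt_pos_iff (Y : Set (Wr G n)) (a b : RT G n) :
    0 < cnt Y a b ↔ ∃ y ∈ Y, tabAct y a = b := by
  classical
  unfold cnt
  rw [Finset.card_pos]
  simp [Finset.Nonempty]

theorem cnt_lt (Y Z : Set (Wr G n)) (a b : RT G n) (h : ∀ y ∈ Y, tabAct y a = b → y ∈ Z)
    (w : Wr G n) (hw : tabAct w a = b) (hwZ : w ∈ Z) (hwY : w ∉ Y) : cnt Y a b < cnt Z a b := by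
  classical
  apply Finset.card_lt_card
  rw [Finset.ssubset_iff_of_subset]
  · exact ⟨w, by simp [hw, hwZ], by simp [hwY]⟩
  · intro y hy
    simp only [Finset.mem_filter, Finset.mem_univ, true_and] at hy ⊢
    exact ⟨h y hy.1 hy.2, hy.2⟩

theorem cnt_le (Y Z : Set (Wr G n)) (a b : RT G n) (h : ∀ y ∈ Y, tabAct y a = b → y ∈ Z) :
    cnt Y a b ≤ cnt Z a b := by
  classical
  apply Finset.card_le_card
  intro y hy
  simp only [Finset.mem_filter, Finset.mem_univ, true_and] at hy ⊢
  exact ⟨h y hy.1 hy.2, hy.2⟩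

/-- The set used when the dominance condition fails. -/
def flipSet (G : Type) [CommGroup G] {n : ℕ} (c : Fin n → ℕ) : Set (Wr G n) :=
  {y | Equiv.Perm.sign y.right = 1 ↔ ¬ ∀ z, c (y.right z) = c z}

theorem sign_swap_mul (x y : Fin n) (hxy : x ≠ y) (π : Equiv.Perm (Fin n)) :
    Equiv.Perm.sign (Equiv.swap x y * π) = 1 ↔ ¬ Equiv.Perm.sign π = 1 := by
  rw [Equiv.Perm.sign_mul, Equiv.Perm.sign_swap hxy]
  rcases Int.units_eq_one_or (Equiv.Perm.sign π) with h | h <;> rw [h] <;> decide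

theorem flip_mul (c : Fin n → ℕ) (x y : Fin n) (hxy : x ≠ y) (hc : c x = c y) (w : Wr G n)
    (hw : w.right = Equiv.swap x y) (v : Wr G n) : w * v ∈ flipSet G c ↔ v ∉ flipSet G c := by
  unfold flipSet
  simp only [Set.mem_ofPred_eq, SemidirectProduct.mul_right, hw, sign_swap_mul x y hxy]
  have : ∀ z, c ((Equiv.swap x y * v.right) z) = c (v.right z) := by
    intro z
    rw [Equiv.Perm.mul_apply, Equiv.swap_apply_def]
    split_ifs with h1 h2
    · rw [h1, hc]
    · rw [h2, hc]
    · rfl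
  simp only [this]
  tauto

theorem swap_block (r : Fin n → ℕ ⊕ ℕ) (x y : Fin n) (h : r x = r y) (z : Fin n) :
    r (Equiv.swap x y z) = r z := by
  rw [Equiv.swap_apply_def]
  split_ifs with h1 h2
  · rw [h1, h]
  · rw [h2, h]
  · rfl

theorem not_dom_of_phi (σ ρ τ π : Multiset ℕ) (S : Finset (ℕ ⊕ ℕ)) (q : ℕ)
    (hq : phi S (shp τ π) q < phi S (shp σ ρ) q)
    (hne : ∃ a, a ∈ Tab G n (shp σ ρ))
    (hoff : ∀ x, x ∉ S → shp τ π x = 0) (hsum : ∑ x ∈ S, shp τ π x = n) :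
    ¬ DPDom G n σ ρ τ π := by
  intro hdom
  obtain ⟨r, c, hr, hinj, hc⟩ := exists_young n _ S hoff hsum
  have hcol : ∀ b ∈ Tab G n (shp σ ρ), ∃ x y, x ≠ y ∧ c x = c y ∧ b.1 x = b.1 y :=
    fun b hb => exists_collision q hq hoff hinj hc hb.1
  have htr : DPTransitive G n σ ρ (flipSet G c) := by
    apply dpt_of_mul (D := 2)
    intro a ha b hb
    obtain ⟨x, y, hxy, hcxy, hbxy⟩ := hcol b hb
    obtain ⟨w, hw, hwb⟩ := exists_lift (a := b) hb (Equiv.swap x y) (swap_block b.1 x y hbxy)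
    have h1 := cnt_le_of_mul w (flipSet G c) (flipSet G c)ᶜ a b b hwb
      (fun v hv hh => ((flip_mul c x y hxy hcxy w hw v).1 hh) hv)
    have h2 := cnt_le_of_mul w (flipSet G c)ᶜ (flipSet G c) a b b hwb
      (fun v hv => (flip_mul c x y hxy hcxy w hw v).2 hv)
    have h3 := cnt_compl (flipSet G c) a b
    omega
  have htr2 := hdom _ htr
  rw [dpt_iff] at htr2
  obtain ⟨d, hd, htr2⟩ := htr2
  obtain ⟨a0, ha0⟩ := hne
  obtain ⟨x, y, hxy, hcxy, -⟩ := hcol a0 ha0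
  have hb0 : ((r, fun _ => 1) : RT G n) ∈ Tab G n (shp τ π) := tab_of_blocks hr
  set b0 : RT G n := (r, fun _ => 1) with hb0d
  set ws : Wr G n := ⟨1, Equiv.swap x y⟩ with hws
  have hb1 := tabAct_mem ws hb0
  have hws2 : tabAct ws (tabAct ws b0) = b0 := by
    rw [← tabAct_mul, tabAct_eq_iff _ _ _ hb0.2]
    intro z
    have e1 : (ws * ws).right = 1 := by
      simp [hws]
    have e2 : (ws * ws).left = 1 := by
      simp [hws]
    rw [e1, e2]
    refine ⟨rfl, fun i _ => ?_⟩
    simp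
  have hcc : cnt (flipSet G c) b0 b0 = cnt (flipSet G c)ᶜ b0 b0 := by
    have h1 := cnt_le_of_mul ws (flipSet G c) (flipSet G c)ᶜ b0 (tabAct ws b0) b0 hws2
      (fun v hv hh => ((flip_mul c x y hxy hcxy ws rfl v).1 hh) hv)
    have h2 := cnt_le_of_mul ws (flipSet G c)ᶜ (flipSet G c) b0 b0 _ rfl
      (fun v hv => (flip_mul c x y hxy hcxy ws rfl v).2 hv)
    have h3 := htr2 b0 hb0 b0 hb0
    have h4 := htr2 b0 hb0 _ hb1
    omega
  have hpos : 0 < cnt (flipSet G c) b0 b0 := by rw [htr2 b0 hb0 b0 hb0]; exact hd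
  rw [cnt_pos_iff] at hpos
  obtain ⟨v, hv, hvb⟩ := hpos
  have hblk : ∀ v : Wr G n, tabAct v b0 = b0 → ∀ z, r (v.right z) = r z := by
    intro v hv z
    rw [tabAct_eq_iff _ _ _ hb0.2] at hv
    exact (hv z).1
  have htriv : ∀ v : Wr G n, tabAct v b0 = b0 → (∀ z, c (v.right z) = c z) → v.right = 1 := by
    intro v h1 h2
    ext1 z
    exact hinj _ _ (hblk v h1 z) (h2 z)
  have hv1 : v.right ≠ 1 := by
    intro h
    have hv' : Equiv.Perm.sign v.right = 1 ↔ ¬ ∀ z, c (v.right z) = c z := hv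
    rw [h] at hv'
    simp at hv'
  obtain ⟨u, hu⟩ : ∃ u, v.right u ≠ u := by
    by_contra hcon
    push Not at hcon
    exact hv1 (Equiv.ext hcon)
  obtain ⟨w2, hw2, hw2b⟩ := exists_lift (a := b0) hb0 (Equiv.swap (v.right u) u)
    (swap_block r _ _ (hblk v hvb u))
  set E : Set (Wr G n) := {y | Equiv.Perm.sign y.right = 1} with hE
  have hEO : cnt E b0 b0 ≤ cnt Eᶜ b0 b0 := by
    apply cnt_le_of_mul w2 _ _ _ _ _ hw2b
    intro y hy hh
    have hh' : Equiv.Perm.sign (w2 * y).right = 1 := hh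
    rw [SemidirectProduct.mul_right, hw2, sign_swap_mul _ _ hu] at hh'
    exact hh' hy
  have hsub : ∀ y ∈ flipSet G c, tabAct y b0 = b0 → y ∈ E := by
    intro y hy hyb
    have hy' : Equiv.Perm.sign y.right = 1 ↔ ¬ ∀ z, c (y.right z) = c z := hy
    change Equiv.Perm.sign y.right = 1
    by_contra hs
    have hC : ∀ z, c (y.right z) = c z := by
      by_contra hC
      exact hs (hy'.2 hC)
    apply hs
    rw [htriv y hyb hC]
    simp
  have h1b : tabAct (1 : Wr G n) b0 = b0 := by
    rw [tabAct_eq_iff _ _ _ hb0.2]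
    intro z
    refine ⟨rfl, fun i _ => ?_⟩
    simp [hb0d]
  have hlt := cnt_lt (flipSet G c) E b0 b0 hsub 1 h1b (by simp [hE]) (by simp [flipSet])
  have hle := cnt_le Eᶜ (flipSet G c)ᶜ b0 b0 (fun y hy hyb hyf => hy (hsub y hyf hyb))
  omega

theorem not_dom_of_lt [Nontrivial G] (σ τ : Multiset ℕ) (k ℓ m : ℕ) (hkl : ℓ < k)
    (hm : τ.card ≤ m)
    (hne : ∃ a, a ∈ Tab G n (shp σ {k})) (hsum : ∑ x ∈ idx m, shp τ {ℓ} x = n) :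
    ¬ DPDom G n σ {k} τ {ℓ} := by
  classical
  intro hdom
  obtain ⟨r, c, hr, hinj, hc⟩ := exists_young n _ (idx m) (shp_off τ ℓ m hm) hsum
  set M : Finset (Fin n) := Finset.univ.filter (fun z => r z ≠ Sum.inr 0) with hM
  have hMm : ∀ z, z ∈ M ↔ r z ≠ Sum.inr 0 := by intro z; simp [hM]
  have hMl : ∀ z ∈ M, ∃ i, r z = Sum.inl i := by
    intro z hz
    rw [hMm] at hz
    have h1 := hc z
    by_cases h2 : r z ∈ idx m
    · simp only [idx, Finset.mem_insert, Finset.mem_image] at h2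
      rcases h2 with h2 | ⟨i, _, h2⟩
      · exact (hz h2).elim
      · exact ⟨i, h2.symm⟩
    · rw [shp_off τ ℓ m hm _ h2] at h1
      omega
  have hmeet : ∀ b ∈ Tab G n (shp σ {k}), ∃ z ∈ M, b.1 z = Sum.inr 0 := by
    intro b hb
    obtain ⟨z, h1, h2⟩ := Finset.exists_mem_notMem_of_card_lt_card
      (s := Finset.univ.filter (fun z => r z = Sum.inr 0))
      (t := Finset.univ.filter (fun z => b.1 z = Sum.inr 0))
      (by rw [hr, hb.1]; simpa [shp, dparts_single] using hkl)
    refine ⟨z, ?_, (Finset.mem_filter.1 h1).2⟩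
    rw [hMm]
    intro h
    exact h2 (by simp [h])
  set Y : G → Set (Wr G n) := fun g => {y | ∏ z ∈ M, y.left z = g} with hY
  have htr : DPTransitive G n σ {k} (Y 1) := by
    apply dpt_of_mul (D := Fintype.card G)
    intro a ha b hb
    obtain ⟨z0, hz0, hbz0⟩ := hmeet b hb
    have hle : ∀ g h : G, cnt (Y g) a b ≤ cnt (Y h) a b := by
      intro g h
      apply cnt_le_of_mul ⟨Pi.mulSingle z0 (h / g), 1⟩
      · rw [tabAct_eq_iff _ _ _ hb.2]
        intro z
        refine ⟨rfl, fun i hi => ?_⟩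
        have : z ≠ z0 := by
          rintro rfl
          rw [hbz0] at hi
          cases hi
        simp [this]
      · intro y hy
        have hy' : ∏ z ∈ M, y.left z = g := hy
        change ∏ z ∈ M, _ = h
        simp only [SemidirectProduct.mul_left, map_one, MulAut.one_apply, Pi.mul_apply]
        rw [Finset.prod_mul_distrib, hy', Finset.prod_pi_mulSingle', if_pos hz0]
        simp
    have hsumc : cnt Set.univ a b = ∑ g : G, cnt (Y g) a b := by
      unfold cnt
      rw [Finset.card_eq_sum_card_fiberwise (f := fun y : Wr G n => ∏ z ∈ M, y.left z)
        (t := Finset.univ) (fun _ _ => Finset.mem_coe.2 (Finset.mem_univ _))]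
      apply Finset.sum_congr rfl
      intro g _
      congr 1
      ext y
      simp only [Finset.mem_filter, Finset.mem_univ, true_and, Set.mem_univ, hY,
        Set.mem_ofPred_eq]
      tauto
    rw [hsumc, Finset.sum_congr rfl (fun g _ => le_antisymm (hle g 1) (hle 1 g)), Finset.sum_const,
      Finset.card_univ, smul_eq_mul]
  have htr2 := hdom _ htr
  rw [dpt_iff] at htr2
  obtain ⟨d, hd, htr2⟩ := htr2
  obtain ⟨a0, ha0⟩ := hne
  obtain ⟨z1, hz1, -⟩ := hmeet a0 ha0
  obtain ⟨g, hg⟩ := exists_ne (1 : G)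
  have hb0 : ((r, fun _ => 1) : RT G n) ∈ Tab G n (shp τ {ℓ}) := tab_of_blocks hr
  have hb1 : ((r, Pi.mulSingle z1 g) : RT G n) ∈ Tab G n (shp τ {ℓ}) := by
    refine ⟨hr, ?_⟩
    intro z j hz
    have : z ≠ z1 := by
      rintro rfl
      obtain ⟨i, hi⟩ := hMl z hz1
      have hz' : r z = Sum.inr j := hz
      rw [hi] at hz'
      cases hz'
    simp [this]
  have hpos : 0 < cnt (Y 1) ((r, fun _ => 1) : RT G n) (r, Pi.mulSingle z1 g) := by
    rw [htr2 _ hb0 _ hb1]; exact hd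
  rw [cnt_pos_iff] at hpos
  obtain ⟨y, hy, hyb⟩ := hpos
  rw [tabAct_eq_iff _ _ _ hb1.2] at hyb
  have hy' : ∏ z ∈ M, y.left z = 1 := hy
  apply hg
  rw [← hy']
  have : ∏ z ∈ M, y.left z = ∏ z ∈ M, (Pi.mulSingle z1 g : Fin n → G) z := by
    apply Finset.prod_congr rfl
    intro z hz
    obtain ⟨i, hi⟩ := hMl z hz
    have h1 := hyb (y.right.symm z)
    simp only [Equiv.apply_symm_apply, one_mul] at h1
    exact (h1.2 i (h1.1.symm.trans hi)).symm
  rw [this, Finset.prod_pi_mulSingle', if_pos hz1]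

end constructions

/-- **Characterisation of `≽` for parabolic types.**
Let `G` be a nontrivial finite abelian group, let `k`, `ℓ` be nonnegative integers,
`σ` a partition of `n - k` and `τ` a partition of `n - ℓ`, so that `(σ,(k))` and
`(τ,(ℓ))` are double partitions of `n`.  Then `(σ,(k)) ≽_G (τ,(ℓ))` if and only if
`k ≤ ℓ` and `σ ∪ (k) ⊴ τ ∪ (ℓ)`. -/
theorem parabolic_characterisation (G : Type) [CommGroup G] [Fintype G] [Nontrivial G]
    (n k ℓ : ℕ) (hn : 1 ≤ n) (σ τ : Multiset ℕ) (hσ0 : 0 ∉ σ) (hτ0 : 0 ∉ τ)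
    (hσ : σ.sum + k = n) (hτ : τ.sum + ℓ = n) :
    DPDom G n σ {k} τ {ℓ} ↔ (k ≤ ℓ ∧ msDom (σ + {k}) (τ + {ℓ})) := by
  classical
  set m := max σ.card τ.card with hm
  have hmσ : σ.card ≤ m := le_max_left _ _
  have hmτ : τ.card ≤ m := le_max_right _ _
  have hsσ : ∑ x ∈ idx m, shp σ {k} x = n := by
    have := shp_sum σ k m hmσ id rfl
    simp at this
    omega
  have hsτ : ∑ x ∈ idx m, shp τ {ℓ} x = n := by
    have := shp_sum τ ℓ m hmτ id rfl
    simp at this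
    omega
  have hne : ∃ a, a ∈ Tab G n (shp σ {k}) := by
    obtain ⟨r, c, hr, -, -⟩ := exists_young n _ (idx m) (shp_off σ k m hmσ) hsσ
    exact ⟨_, tab_of_blocks hr⟩
  have hdom : msDom (σ + {k}) (τ + {ℓ}) ↔
      ∀ r, phi (idx m) (shp σ {k}) r ≤ phi (idx m) (shp τ {ℓ}) r := by
    rw [msDom_iff]
    apply forall_congr'
    intro r
    rw [phi_shp σ k m hmσ, phi_shp τ ℓ m hmτ]
  rw [hdom]
  constructor
  · intro h
    refine ⟨?_, ?_⟩
    · by_contra hkl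
      exact not_dom_of_lt σ τ k ℓ m (not_le.1 hkl) hmτ hne hsτ h
    · intro r
      by_contra hr
      exact not_dom_of_phi σ {k} τ {ℓ} (idx m) r (not_le.1 hr) hne (shp_off τ ℓ m hmτ) hsτ h
  · rintro ⟨hkl, hphi⟩
    apply dpt_of_null _ _ _ _ hne
    intro F hF
    refine null_of_major (idx m) (Sum.inr 0) (by simp [idx]) ?_ _ _ ?_ hphi ?_ ?_ F hF
    · intro x hx hx0
      simp only [idx, Finset.mem_insert, Finset.mem_image] at hx
      rcases hx with hx | ⟨i, _, hx⟩
      · exact (hx0 hx).elim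
      · exact ⟨i, hx.symm⟩
    · simpa [shp, dparts_single] using hkl
    · simp only [phi, Nat.sub_zero]
      rw [hsσ, hsτ]
    · intro x hx
      rw [shp_off σ k m hmσ x hx, shp_off τ ℓ m hmτ x hx]
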